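/- Let n ≥ 1. Suppose W is a finite index set, (v_w)_{w∈W} is a family in Z[X_1,…,X_n] that is a basis of Z[X_1,…,X_n] as a module over the invariant subring Z[X_1,…,X_n]^{S_n}, and (v_w^∨)_{w∈W} is a family in Z[X_1,…,X_n] satisfying ∂_{w[1,n]}(v_{w'} · v_w^∨) = δ_{w,w'} for all w, w' ∈ W. Then Σ_{w∈W} v_w^∨ · v_w = ∏_{1≤j<i≤n} (X_i − X_j). -/

import Mathlib

open scoped BigOperators

namespace Dem

/-- The polynomial ring `ℤ[X_1, …, X_n]` (0-based variables). -/
abbrev R (n : ℕ) := MvPolynomial (Fin n) ℤ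

/-- `D` is the family of Demazure (BGG) operators `∂_i` (0-based), characterized
by `(X_{i+1} - X_i) · ∂_i P = P - s_i(P)`. -/
def IsDemFamily {n : ℕ} (D : ℕ → R n → R n) : Prop :=
  ∀ (i : ℕ) (h : i + 1 < n) (P : R n),
    (MvPolynomial.X (⟨i + 1, h⟩ : Fin n) - MvPolynomial.X ⟨i, by omega⟩) * D i P
      = P - MvPolynomial.rename (Equiv.swap (⟨i, by omega⟩ : Fin n) ⟨i + 1, h⟩) P

/-- `∂_w = ∂_{i_1} ∘ ⋯ ∘ ∂_{i_r}` for a word `l = [i_1, …, i_r]` (rightmost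
applied first). -/
def applyWord {n : ℕ} (D : ℕ → R n → R n) (l : List ℕ) (P : R n) : R n :=
  l.foldr (fun i Q => D i Q) P

/-- The permutation of `Fin n` given by a word in the simple transpositions. -/
def permOfWord (n : ℕ) (l : List ℕ) : Equiv.Perm (Fin n) :=
  (l.map fun i =>
    if h : i + 1 < n then Equiv.swap (⟨i, by omega⟩ : Fin n) ⟨i + 1, h⟩ else 1).prod

/-- `l` is a reduced word for the permutation `w`. -/
def IsReducedWordFor (n : ℕ) (l : List ℕ) (w : Equiv.Perm (Fin n)) : Prop :=
  (∀ i ∈ l, i + 1 < n) ∧ permOfWord n l = w ∧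
    ∀ l' : List ℕ, (∀ i ∈ l', i + 1 < n) → permOfWord n l' = w → l.length ≤ l'.length

/-- The standard reduced word for the longest element of `S_m` (0-based). -/
def longWord (m : ℕ) : List ℕ :=
  (List.range m).foldr (fun j acc => (List.range j).reverse ++ acc) []

/-- The set of variables `X_{lo+1}, …, X_n` (0-based indices `≥ lo`). -/
def varsFrom (n lo : ℕ) : Finset (Fin n) :=
  Finset.univ.filter fun a : Fin n => lo ≤ a.val

/-- The set of variables `X_1, …, X_m` (0-based indices `< m`). -/
def varsUpto (n m : ℕ) : Finset (Fin n) :=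
  Finset.univ.filter fun a : Fin n => a.val < m

/-- Elementary symmetric polynomial of degree `m` in the variables of `s`. -/
noncomputable def eOn {n : ℕ} (s : Finset (Fin n)) (m : ℕ) : R n :=
  ∑ T ∈ s.powersetCard m, ∏ a ∈ T, MvPolynomial.X a

/-- Complete homogeneous symmetric polynomial of degree `j` in the variables of
`s`. -/
noncomputable def hOn {n : ℕ} (s : Finset (Fin n)) (j : ℕ) : R n :=
  ∑ d ∈ s.sym j, (Multiset.map MvPolynomial.X (d : Multiset (Fin n))).prod

/-- `P` is symmetric in the variables with (0-based) index `≥ lo`. -/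
def SymFrom {n : ℕ} (lo : ℕ) (P : R n) : Prop :=
  ∀ a b : Fin n, lo ≤ a.val → lo ≤ b.val →
    MvPolynomial.rename (Equiv.swap a b) P = P

/-- The monomial symmetric polynomial in the first `c` of the `n` variables,
attached to the exponent vector `w` (the sum of the distinct monomials in the
`S_c`-orbit of `X_1^{w_1} ⋯ X_c^{w_c}`). -/
noncomputable def msymBlock {n : ℕ} (c : ℕ) (w : Fin c → ℕ) : R n :=
  ∑ g ∈ Finset.image
      (fun σ : Equiv.Perm (Fin c) =>
        fun i : Fin n => if h : i.val < c then w (σ ⟨i.val, h⟩) else 0)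
      Finset.univ,
    ∏ i, MvPolynomial.X i ^ g i

end Dem

namespace NilCoxeter

variable {A : Type*} [MonoidWithZero A]

/-- The defining relations of the nil-Coxeter monoid of type `A`. -/
structure Relations (E : ℕ → A) : Prop where
  sq (i : ℕ) : E i * E i = 0
  comm (i j : ℕ) (h : i + 1 < j) : E i * E j = E j * E i
  braid (i : ℕ) : E i * E (i + 1) * E i = E (i + 1) * E i * E (i + 1)

/-- The product `E a * E (a + 1) * ⋯ * E (a + k - 1)`. -/
def block (E : ℕ → A) : ℕ → ℕ → A
  | _, 0 => 1
  | a, k + 1 => E a * block E (a + 1) k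

/-- The normal form of maximal length in the letters `E 0, …, E (d - 1)`. -/
def longest (E : ℕ → A) : ℕ → A
  | 0 => 1
  | d + 1 => block E 0 (d + 1) * longest E d

/-- `Normal E d x r`: `x` is a normal form of length `r` in the letters `E 0, …, E (d - 1)`. -/
inductive Normal (E : ℕ → A) : ℕ → A → ℕ → Prop
  | zero : Normal E 0 1 0
  | succ (a k d : ℕ) (x : A) (r : ℕ) (h : a + k = d + 1) (hx : Normal E d x r) :
      Normal E (d + 1) (block E a k * x) (k + r)

variable {E : ℕ → A}

theorem Relations.mul_block_of_lt (hE : Relations E) {i a : ℕ} (h : i + 1 < a) (k : ℕ) :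
    E i * block E a k = block E a k * E i := by
  induction k generalizing a with
  | zero => simp [block]
  | succ k ih =>
    rw [block, ← mul_assoc, hE.comm i a h, mul_assoc, ih (by omega), mul_assoc]

theorem Relations.mul_block_of_mem (hE : Relations E) {i a k : ℕ} (h : a ≤ i)
    (hk : i + 1 < a + k) : E (i + 1) * block E a k = block E a k * E i := by
  induction k generalizing a with
  | zero => omega
  | succ k ih =>
    rcases h.eq_or_lt with rfl | h
    · obtain ⟨k, rfl⟩ : ∃ m, k = m + 1 := ⟨k - 1, by omega⟩
      simp only [block]
      rw [← mul_assoc, ← mul_assoc, ← hE.braid, mul_assoc, hE.mul_block_of_lt (by omega)]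
      simp only [mul_assoc]
    · rw [block, ← mul_assoc, ← hE.comm a (i + 1) (by omega), mul_assoc,
        ih (by omega) (by omega), mul_assoc]

theorem Relations.mul_normal (hE : Relations E) {d r : ℕ} {x : A} (hx : Normal E d x r)
    {i : ℕ} (hi : i < d) : E i * x = 0 ∨ Normal E d (E i * x) (r + 1) := by
  induction hx generalizing i with
  | zero => omega
  | succ a k d x r h hx ih =>
    have shift : ∀ j < d, E i * block E a k = block E a k * E j →
        E i * (block E a k * x) = 0 ∨
          Normal E (d + 1) (E i * (block E a k * x)) (k + r + 1) := by
      intro j hj hcomm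
      rw [← mul_assoc, hcomm, mul_assoc]
      rcases ih hj with h0 | hn
      · left; rw [h0, mul_zero]
      · right; exact Normal.succ a k d _ _ h hn
    rcases lt_trichotomy i a with hia | rfl | hia
    · rcases Nat.lt_or_ge (i + 1) a with h1 | h1
      · exact shift i (by omega) (hE.mul_block_of_lt h1 k)
      · obtain rfl : a = i + 1 := by omega
        right
        have := Normal.succ i (k + 1) d x r (by omega) hx
        rwa [block, mul_assoc, Nat.add_right_comm] at this
    · obtain ⟨k, rfl⟩ : ∃ m, k = m + 1 := ⟨k - 1, by omega⟩
      left
      rw [block, ← mul_assoc, ← mul_assoc, hE.sq, zero_mul, zero_mul]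
    · obtain ⟨i, rfl⟩ : ∃ m, i = m + 1 := ⟨i - 1, by omega⟩
      exact shift i (by omega) (hE.mul_block_of_mem (by omega) (by omega))

theorem normal_one (d : ℕ) : Normal E d 1 0 := by
  induction d with
  | zero => exact Normal.zero
  | succ d ih => simpa [block] using Normal.succ (d + 1) 0 d 1 0 rfl ih

theorem Relations.prod_normal (hE : Relations E) {d : ℕ} (l : List ℕ) (hl : ∀ i ∈ l, i < d) :
    (l.map E).prod = 0 ∨ Normal E d (l.map E).prod l.length := by
  induction l with
  | nil => right; simpa using normal_one d
  | cons i l ih =>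
    simp only [List.map_cons, List.prod_cons, List.length_cons]
    rcases ih fun j hj => hl j (List.mem_cons_of_mem _ hj) with h | h
    · left; rw [h, mul_zero]
    · exact hE.mul_normal h (hl i List.mem_cons_self)

theorem choose_two_add_two (d : ℕ) : (d + 1 + 1).choose 2 = d + 1 + (d + 1).choose 2 := by
  rw [Nat.choose_succ_succ' (d + 1) 1, Nat.choose_one_right]

theorem Normal.length_le {d r : ℕ} {x : A} (hx : Normal E d x r) : r ≤ (d + 1).choose 2 := by
  induction hx with
  | zero => simp
  | succ a k d x r h hx ih =>
    rw [choose_two_add_two]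
    omega

theorem Normal.eq_longest {d r : ℕ} {x : A} (hx : Normal E d x r)
    (hr : r = (d + 1).choose 2) : x = longest E d := by
  induction hx with
  | zero => rfl
  | succ a k d x r h hx ih =>
    have := hx.length_le
    rw [choose_two_add_two] at hr
    obtain rfl : a = 0 := by omega
    obtain rfl : k = d + 1 := by omega
    rw [longest, ih (by omega)]

end NilCoxeter

namespace Dem

open MvPolynomial

variable {n : ℕ}

/-- The transposition of the variables `i` and `i + 1`. -/
def adj (i : ℕ) (h : i + 1 < n) : Equiv.Perm (Fin n) :=
  Equiv.swap ⟨i, by omega⟩ ⟨i + 1, h⟩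

theorem adj_braid (i : ℕ) (hi : i + 1 < n) (h : i + 1 + 1 < n) :
    adj i hi * (adj (i + 1) h * adj i hi) = adj (i + 1) h * (adj i hi * adj (i + 1) h) := by
  set a : Fin n := ⟨i, by omega⟩ with ha
  set b : Fin n := ⟨i + 1, hi⟩ with hb
  set c : Fin n := ⟨i + 1 + 1, h⟩ with hc
  have hab : a ≠ b := by simp [ha, hb]
  have hac : a ≠ c := by simp [ha, hc]; omega
  have hbc : b ≠ c := by simp [hb, hc]
  change Equiv.swap a b * (Equiv.swap b c * Equiv.swap a b)
    = Equiv.swap b c * (Equiv.swap a b * Equiv.swap b c)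
  rw [← mul_assoc, ← mul_assoc, Equiv.swap_mul_swap_mul_swap hab hac, Equiv.swap_comm a b,
    Equiv.swap_comm b c, Equiv.swap_mul_swap_mul_swap hbc.symm hac.symm, Equiv.swap_comm]

theorem rename_adj_X_left (i : ℕ) (h : i + 1 < n) :
    rename (adj i h) (X ⟨i, by omega⟩ : R n) = X ⟨i + 1, h⟩ := by
  simp [adj]

theorem rename_adj_X_right (i : ℕ) (h : i + 1 < n) :
    rename (adj i h) (X ⟨i + 1, h⟩ : R n) = X ⟨i, by omega⟩ := by
  simp [adj]

theorem rename_adj_X_of_ne (i : ℕ) (h : i + 1 < n) (j : ℕ) (hj : j < n) (h1 : j ≠ i)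
    (h2 : j ≠ i + 1) : rename (adj i h) (X ⟨j, hj⟩ : R n) = X ⟨j, hj⟩ := by
  rw [rename_X, adj, Equiv.swap_apply_of_ne_of_ne] <;> simpa using ‹_›

theorem rename_mul_apply (σ τ : Equiv.Perm (Fin n)) (P : R n) :
    rename (σ * τ) P = rename σ (rename τ P) := by
  rw [rename_rename]; rfl

theorem X_sub_X_ne_zero {i j : ℕ} (hi : i < n) (hj : j < n) (h : i ≠ j) :
    (X ⟨i, hi⟩ - X ⟨j, hj⟩ : R n) ≠ 0 := by
  rw [sub_ne_zero]
  intro h'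
  exact h (by simpa using X_injective h')

theorem addEnd_mul_apply (f g : AddMonoid.End (R n)) (P : R n) : (f * g) P = f (g P) := rfl

namespace IsDemFamily

variable {D : ℕ → R n → R n} {i j : ℕ}

theorem D_eq_of_mul_eq (hD : IsDemFamily D) (h : i + 1 < n) {P Q : R n}
    (hQ : (X ⟨i + 1, h⟩ - X ⟨i, by omega⟩) * Q = P - rename (adj i h) P) : D i P = Q :=
  mul_left_cancel₀ (X_sub_X_ne_zero h (by omega) (by omega)) ((hD i h P).trans hQ.symm)

theorem D_add (hD : IsDemFamily D) (h : i + 1 < n) (P Q : R n) : D i (P + Q) = D i P + D i Q := by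
  apply hD.D_eq_of_mul_eq h
  rw [mul_add, hD i h, hD i h, map_add]
  simp only [adj]
  ring

theorem D_mul_of_invariant (hD : IsDemFamily D) (h : i + 1 < n) {S : R n}
    (hS : rename (adj i h) S = S) (P : R n) :
    D i (S * P) = S * D i P := by
  apply hD.D_eq_of_mul_eq h
  rw [mul_left_comm, hD i h, map_mul, hS]
  simp only [adj]
  ring

theorem D_eq_zero_of_invariant (hD : IsDemFamily D) (h : i + 1 < n) {S : R n}
    (hS : rename (adj i h) S = S) :
    D i S = 0 := by
  apply hD.D_eq_of_mul_eq h
  rw [hS]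
  ring

theorem D_X_mul_of_invariant (hD : IsDemFamily D) (h : i + 1 < n) {S : R n}
    (hS : rename (adj i h) S = S) :
    D i (X ⟨i + 1, h⟩ * S) = S := by
  apply hD.D_eq_of_mul_eq h
  rw [map_mul, hS, rename_adj_X_right]
  ring

theorem rename_adj_D (hD : IsDemFamily D) (h : i + 1 < n) (P : R n) :
    rename (adj i h) (D i P) = D i P := by
  have h1 := hD i h P
  have h2 := congrArg (rename (adj i h)) h1
  have h3 : rename (adj i h) (rename (adj i h) P) = P := by
    rw [← rename_mul_apply, adj, Equiv.swap_mul_self]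
    exact rename_id_apply P
  rw [map_mul, map_sub, map_sub, rename_adj_X_left, rename_adj_X_right] at h2
  change _ = _ - rename (adj i h) (rename (adj i h) P) at h2
  rw [h3] at h2
  apply mul_left_cancel₀ (X_sub_X_ne_zero h (by omega) (by omega : i + 1 ≠ i))
  rw [h1]
  change _ = _ - rename (adj i h) P
  linear_combination -h2

theorem D_sq (hD : IsDemFamily D) (h : i + 1 < n) (P : R n) : D i (D i P) = 0 :=
  hD.D_eq_zero_of_invariant h (hD.rename_adj_D h P)

theorem mul_rename_D (hD : IsDemFamily D) (h : i + 1 < n) (P : R n) (σ : Equiv.Perm (Fin n)) :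
    (rename σ (X ⟨i + 1, h⟩) - rename σ (X ⟨i, by omega⟩)) * rename σ (D i P)
      = rename σ P - rename σ (rename (adj i h) P) := by
  rw [← map_sub, ← map_mul, hD i h, map_sub]
  rfl

theorem D_comm (hD : IsDemFamily D) (hi : i + 1 < n) (hj : j + 1 < n) (hij : i + 1 < j) (P : R n) :
    D i (D j P) = D j (D i P) := by
  apply hD.D_eq_of_mul_eq hi
  apply mul_left_cancel₀ (X_sub_X_ne_zero hj (by omega) (by omega : j + 1 ≠ j))
  have e1 := hD j hj (D i P)
  have e2 := hD j hj P
  have e3 := hD i hi P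
  have e4 := hD.mul_rename_D hi P (adj j hj)
  have e5 := hD.mul_rename_D hj P (adj i hi)
  rw [rename_adj_X_of_ne _ _ _ _ (by omega) (by omega),
    rename_adj_X_of_ne _ _ _ _ (by omega) (by omega)] at e4 e5
  have e6 : rename (adj i hi) (rename (adj j hj) P) = rename (adj j hj) (rename (adj i hi) P) := by
    rw [← rename_mul_apply, ← rename_mul_apply]
    congr 3
    apply Equiv.Perm.Disjoint.commute
    rw [Equiv.Perm.disjoint_iff_disjoint_support, adj, adj, Equiv.Perm.support_swap (by simp),
      Equiv.Perm.support_swap (by simp)]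
    simp
    omega
  change _ = _ - rename (adj j hj) (D i P) at e1
  change _ = _ - rename (adj j hj) P at e2
  change _ = _ - rename (adj i hi) P at e3
  linear_combination (X ⟨i + 1, hi⟩ - X ⟨i, by omega⟩) * e1 + e3 - e4 - e2 + e5 - e6

theorem D_braid (hD : IsDemFamily D) (h : i + 1 + 1 < n) (P : R n) :
    D i (D (i + 1) (D i P)) = D (i + 1) (D i (D (i + 1) P)) := by
  have hi : i + 1 < n := by omega
  set s := rename (R := ℤ) (adj i hi) with hs
  set t := rename (R := ℤ) (adj (i + 1) h) with ht
  set a : R n := X ⟨i, by omega⟩ with ha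
  set b : R n := X ⟨i + 1, hi⟩ with hb
  set c : R n := X ⟨i + 1 + 1, h⟩ with hc
  have sa : s a = b := rename_adj_X_left i hi
  have sb : s b = a := rename_adj_X_right i hi
  have sc : s c = c := rename_adj_X_of_ne i hi _ _ (by omega) (by omega)
  have ta : t a = a := rename_adj_X_of_ne _ h _ _ (by omega) (by omega)
  have tb : t b = c := rename_adj_X_left _ h
  have tc : t c = b := rename_adj_X_right _ h
  have es (Q : R n) : (b - a) * D i Q = Q - s Q := hD i hi Q
  have et (Q : R n) : (c - b) * D (i + 1) Q = Q - t Q := hD (i + 1) h Q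
  have sD (Q : R n) : s (D i Q) = D i Q := hD.rename_adj_D hi Q
  have tD (Q : R n) : t (D (i + 1) Q) = D (i + 1) Q := hD.rename_adj_D h Q
  have hst : s (t (s P)) = t (s (t P)) := by
    simp only [hs, ht, ← rename_mul_apply]
    rw [adj_braid]
  have key1 : (b - a) * (c - b) * (c - a) * D i (D (i + 1) (D i P))
      = P - s P - t P + t (s P) + s (t P) - s (t (s P)) := by
    have e1 := es (D (i + 1) (D i P))
    have e2 := et (D i P)
    have e3 := congrArg s e2
    have e4 := congrArg t (es P)
    have e5 := congrArg s e4
    simp only [map_mul, map_sub, sa, sb, sc, ta, tb, sD] at e3 e4 e5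
    linear_combination (c - b) * (c - a) * e1 + (c - a) * e2 - (c - b) * e3 + es P - e4 + e5
  have key2 : (b - a) * (c - b) * (c - a) * D (i + 1) (D i (D (i + 1) P))
      = P - t P - s P + s (t P) + t (s P) - t (s (t P)) := by
    have e1 := et (D i (D (i + 1) P))
    have e2 := es (D (i + 1) P)
    have e3 := congrArg t e2
    have e4 := congrArg s (et P)
    have e5 := congrArg t e4
    simp only [map_mul, map_sub, sb, sc, ta, tb, tc, tD] at e3 e4 e5
    linear_combination (b - a) * (c - a) * e1 + (c - a) * e2 - (b - a) * e3 + et P - e4 + e5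
  have hne : (b - a) * (c - b) * (c - a) ≠ 0 :=
    mul_ne_zero (mul_ne_zero (X_sub_X_ne_zero _ _ (by omega)) (X_sub_X_ne_zero _ _ (by omega)))
      (X_sub_X_ne_zero _ _ (by omega))
  apply mul_left_cancel₀ hne
  rw [key1, key2, hst]
  ring

/-- The operator `∂_i` as an additive endomorphism, and zero when `i` is out of range. -/
noncomputable def stepEnd (hD : IsDemFamily D) (i : ℕ) : AddMonoid.End (R n) :=
  if h : i + 1 < n then AddMonoidHom.mk' (D i) (hD.D_add h) else 0

theorem stepEnd_apply (hD : IsDemFamily D) (h : i + 1 < n) (P : R n) :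
    hD.stepEnd i P = D i P :=
  DFunLike.congr_fun
    (show hD.stepEnd i = AddMonoidHom.mk' (D i) (hD.D_add h) from dif_pos h) P

theorem stepEnd_of_not_lt (hD : IsDemFamily D) (h : ¬ i + 1 < n) : hD.stepEnd i = 0 :=
  dif_neg h

theorem stepEnd_sq (hD : IsDemFamily D) (i : ℕ) : hD.stepEnd i * hD.stepEnd i = 0 := by
  by_cases h : i + 1 < n
  · ext1 P
    simp only [addEnd_mul_apply, hD.stepEnd_apply h, hD.D_sq h]
    rfl
  · simp [hD.stepEnd_of_not_lt h]

theorem stepEnd_comm (hD : IsDemFamily D) (h : i + 1 < j) :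
    hD.stepEnd i * hD.stepEnd j = hD.stepEnd j * hD.stepEnd i := by
  by_cases hj : j + 1 < n
  · have hi : i + 1 < n := by omega
    ext1 P
    simp only [addEnd_mul_apply, hD.stepEnd_apply hi, hD.stepEnd_apply hj,
      hD.D_comm hi hj h]
  · simp [hD.stepEnd_of_not_lt hj]

theorem stepEnd_braid (hD : IsDemFamily D) (i : ℕ) :
    hD.stepEnd i * hD.stepEnd (i + 1) * hD.stepEnd i
      = hD.stepEnd (i + 1) * hD.stepEnd i * hD.stepEnd (i + 1) := by
  by_cases h : i + 1 + 1 < n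
  · have hi : i + 1 < n := by omega
    ext1 P
    simp only [addEnd_mul_apply, hD.stepEnd_apply hi, hD.stepEnd_apply h, hD.D_braid h]
  · simp [hD.stepEnd_of_not_lt h]

/-- The operators `∂_i` enumerated from the last one to the first one. -/
noncomputable def revEnd (hD : IsDemFamily D) (j : ℕ) : AddMonoid.End (R n) :=
  if j + 1 < n then hD.stepEnd (n - 2 - j) else 0

theorem revEnd_relations (hD : IsDemFamily D) : NilCoxeter.Relations hD.revEnd where
  sq i := by
    unfold revEnd
    split_ifs
    · exact hD.stepEnd_sq _
    · simp
  comm i j h := by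
    unfold revEnd
    split_ifs
    · exact (hD.stepEnd_comm (by omega)).symm
    all_goals simp
  braid i := by
    unfold revEnd
    split_ifs with h1 h2
    · obtain ⟨k, hk⟩ : ∃ k, n - 2 - (i + 1) = k := ⟨_, rfl⟩
      have hk' : n - 2 - i = k + 1 := by omega
      rw [hk, hk']
      exact (hD.stepEnd_braid k).symm
    all_goals simp

theorem applyWord_eq_prod (hD : IsDemFamily D) (l : List ℕ) (hl : ∀ i ∈ l, i + 1 < n) (P : R n) :
    applyWord D l P = ((l.map fun i => n - 2 - i).map hD.revEnd).prod P := by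
  induction l with
  | nil => simp [applyWord]
  | cons i l ih =>
    have hi := hl i List.mem_cons_self
    have := ih fun j hj => hl j (List.mem_cons_of_mem _ hj)
    simp only [List.map_cons, List.prod_cons, addEnd_mul_apply, ← this]
    rw [revEnd, if_pos (by omega), show n - 2 - (n - 2 - i) = i by omega, hD.stepEnd_apply hi]
    rfl

theorem prod_normal_of_word (hD : IsDemFamily D) (l : List ℕ) (hl : ∀ i ∈ l, i + 1 < n) :
    ((l.map fun i => n - 2 - i).map hD.revEnd).prod = 0 ∨
      NilCoxeter.Normal hD.revEnd (n - 1) ((l.map fun i => n - 2 - i).map hD.revEnd).prod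
        l.length := by
  have := hD.revEnd_relations.prod_normal (d := n - 1) (l.map fun i => n - 2 - i) (by
    intro j hj
    obtain ⟨i, hi, rfl⟩ := List.mem_map.1 hj
    have := hl i hi
    omega)
  rwa [List.length_map] at this

theorem applyWord_eq_zero_of_length (hD : IsDemFamily D) (hn : 1 ≤ n) (l : List ℕ)
    (hl : ∀ i ∈ l, i + 1 < n) (hlen : n.choose 2 < l.length) (P : R n) :
    applyWord D l P = 0 := by
  rw [hD.applyWord_eq_prod l hl]
  rcases hD.prod_normal_of_word l hl with h | h
  · rw [h]; rfl
  · have := h.length_le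
    rw [Nat.sub_add_cancel hn] at this
    omega

/-- Words of length at least `n.choose 2` act by zero or as the longest normal form. -/
theorem applyWord_eq_longest (hD : IsDemFamily D) (hn : 1 ≤ n) (l : List ℕ)
    (hl : ∀ i ∈ l, i + 1 < n) (hlen : n.choose 2 ≤ l.length) :
    (∀ P, applyWord D l P = 0) ∨
      ∀ P, applyWord D l P = NilCoxeter.longest hD.revEnd (n - 1) P := by
  rcases hD.prod_normal_of_word l hl with h | h
  · left; intro P; rw [hD.applyWord_eq_prod l hl, h]; rfl
  · right
    intro P
    have := h.length_le
    have hx := h.eq_longest (by rw [Nat.sub_add_cancel hn] at *; omega)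
    rw [hD.applyWord_eq_prod l hl, hx]

theorem applyWord_add (hD : IsDemFamily D) (l : List ℕ) (hl : ∀ i ∈ l, i + 1 < n) (P Q : R n) :
    applyWord D l (P + Q) = applyWord D l P + applyWord D l Q := by
  simp only [hD.applyWord_eq_prod l hl, map_add]

theorem applyWord_symm_mul (hD : IsDemFamily D) (l : List ℕ) (hl : ∀ i ∈ l, i + 1 < n)
    {S : R n} (hS : S.IsSymmetric) (P : R n) :
    applyWord D l (S * P) = S * applyWord D l P := by
  induction l with
  | nil => rfl
  | cons i l ih =>
    have := ih fun j hj => hl j (List.mem_cons_of_mem _ hj)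
    change D i (applyWord D l (S * P)) = S * D i (applyWord D l P)
    rw [this, hD.D_mul_of_invariant (hl i List.mem_cons_self) (hS _)]

theorem applyWord_rename_adj (hD : IsDemFamily D) (hn : 1 ≤ n) (l : List ℕ)
    (hl : ∀ i ∈ l, i + 1 < n) (hlen : n.choose 2 ≤ l.length) (h : i + 1 < n) (Q : R n) :
    applyWord D l (rename (adj i h) Q) = - applyWord D l Q := by
  have hs : rename (adj i h) (rename (adj i h) Q) = Q := by
    rw [← rename_mul_apply, adj, Equiv.swap_mul_self]
    exact rename_id_apply Q
  have hinv : rename (adj i h) (Q + rename (adj i h) Q) = Q + rename (adj i h) Q := by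
    rw [map_add, hs, add_comm]
  have h0 := hD.applyWord_eq_zero_of_length hn (l ++ [i])
    (by simpa [or_imp, forall_and] using ⟨hl, h⟩) (by simp; omega)
    (X ⟨i + 1, h⟩ * (Q + rename (adj i h) Q))
  have h1 : applyWord D (l ++ [i]) (X ⟨i + 1, h⟩ * (Q + rename (adj i h) Q))
      = applyWord D l (D i (X ⟨i + 1, h⟩ * (Q + rename (adj i h) Q))) := by
    simp [applyWord]
  rw [h1, hD.D_X_mul_of_invariant h hinv, hD.applyWord_add l hl] at h0
  linear_combination h0

end IsDemFamily

/-- The inversions of a permutation. -/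
def inversions (w : Equiv.Perm (Fin n)) : Finset (Fin n × Fin n) :=
  Finset.univ.filter fun p => p.1 < p.2 ∧ w p.2 < w p.1

theorem inversions_adj_mul_subset (i : ℕ) (h : i + 1 < n) (w : Equiv.Perm (Fin n)) :
    inversions (adj i h * w) ⊆
      insert (w.symm ⟨i, by omega⟩, w.symm ⟨i + 1, h⟩) (inversions w) := by
  rintro ⟨p, q⟩ hpq
  simp only [inversions, Finset.mem_filter, Finset.mem_univ, true_and, Finset.mem_insert,
    Prod.mk.injEq, Equiv.eq_symm_apply] at hpq ⊢
  obtain ⟨hlt, hw⟩ := hpq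
  have hne : w p ≠ w q := fun e => hlt.ne (w.injective e)
  rw [Equiv.Perm.mul_apply, Equiv.Perm.mul_apply, adj, Equiv.swap_apply_def,
    Equiv.swap_apply_def] at hw
  simp only [Fin.ext_iff, Fin.lt_def, ne_eq] at *
  split_ifs at hw <;> simp_all <;> omega

theorem card_inversions_permOfWord_le (l : List ℕ) (hl : ∀ i ∈ l, i + 1 < n) :
    (inversions (permOfWord n l)).card ≤ l.length := by
  induction l with
  | nil =>
    simp only [permOfWord, inversions, List.map_nil, List.prod_nil, List.length_nil,
      Nat.le_zero, Finset.card_eq_zero, Finset.filter_eq_empty_iff, Equiv.Perm.one_apply]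
    intro p _ hp
    exact lt_asymm hp.1 hp.2
  | cons i l ih =>
    have hi := hl i List.mem_cons_self
    have := ih fun j hj => hl j (List.mem_cons_of_mem _ hj)
    have hw : permOfWord n (i :: l) = adj i hi * permOfWord n l := by
      simp [permOfWord, hi, adj]
    rw [hw, List.length_cons]
    exact (Finset.card_le_card (inversions_adj_mul_subset i hi _)).trans
      ((Finset.card_insert_le _ _).trans (by omega))

theorem card_inversions_revPerm : (inversions (Fin.revPerm (n := n))).card = n.choose 2 := by
  have h : inversions (Fin.revPerm (n := n)) =
      Finset.univ.filter fun p : Fin n × Fin n => p.1 < p.2 := by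
    simp [inversions]
  rw [h, Finset.card_filter, Fintype.sum_prod_type_right]
  simp only [← Finset.card_filter, Finset.filter_gt_eq_Iio, Fin.card_Iio]
  rw [Fin.sum_univ_eq_sum_range (fun i => i), Finset.sum_range_id, Nat.choose_two_right]

theorem map_rename_eq_sign_smul (T : R n →+ R n)
    (hT : ∀ (i : ℕ) (h : i + 1 < n) (Q : R n), T (rename (adj i h) Q) = - T Q)
    (σ : Equiv.Perm (Fin n)) (Q : R n) :
    T (rename σ Q) = (Equiv.Perm.sign σ : ℤ) • T Q := by
  rcases n with _ | m
  · rw [Subsingleton.elim σ 1]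
    simp
  · have hσ : σ ∈ Submonoid.closure
        (Set.range fun i : Fin m => Equiv.swap i.castSucc i.succ) := by
      rw [Equiv.Perm.mclosure_swap_castSucc_succ]; trivial
    induction hσ using Submonoid.closure_induction generalizing Q with
    | mem σ hσ =>
      obtain ⟨i, rfl⟩ := hσ
      simp only [Equiv.Perm.sign_swap (Fin.castSucc_lt_succ (i := i)).ne]
      rw [Units.val_neg, Units.val_one, neg_smul, one_smul]
      exact hT i (by omega) Q
    | one => simp
    | mul σ τ _ _ h1 h2 =>
      rw [rename_mul_apply, h1, h2, smul_smul, Equiv.Perm.sign_mul, Units.val_mul]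

/-- The antisymmetrization of a polynomial. -/
noncomputable def antisymmetrize (P : R n) : R n :=
  ∑ σ : Equiv.Perm (Fin n), (Equiv.Perm.sign σ : ℤ) • rename σ P

theorem sign_smul_sign_smul (σ : Equiv.Perm (Fin n)) (P : R n) :
    (Equiv.Perm.sign σ : ℤ) • (Equiv.Perm.sign σ : ℤ) • P = P := by
  rw [smul_smul, Int.units_coe_mul_self, one_smul]

theorem rename_antisymmetrize (σ : Equiv.Perm (Fin n)) (P : R n) :
    rename σ (antisymmetrize P) = (Equiv.Perm.sign σ : ℤ) • antisymmetrize P := by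
  rw [antisymmetrize, map_sum, Finset.smul_sum, ← Equiv.sum_comp (Equiv.mulLeft σ)
    fun τ => (Equiv.Perm.sign σ : ℤ) • (Equiv.Perm.sign τ : ℤ) • rename τ P]
  refine Finset.sum_congr rfl fun τ _ => ?_
  rw [map_zsmul, ← rename_mul_apply, Equiv.coe_mulLeft, Equiv.Perm.sign_mul, Units.val_mul,
    mul_smul, sign_smul_sign_smul]

theorem isSymmetric_antisymmetrize_sq (P : R n) :
    (antisymmetrize P * antisymmetrize P).IsSymmetric := by
  intro σ
  rw [map_mul, rename_antisymmetrize, smul_mul_smul_comm, Int.units_coe_mul_self, one_smul]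

theorem isSymmetric_sum_rename (P : R n) :
    (∑ σ : Equiv.Perm (Fin n), rename σ P).IsSymmetric := by
  intro τ
  rw [map_sum, ← Equiv.sum_comp (Equiv.mulLeft τ) fun σ => rename σ P]
  exact Finset.sum_congr rfl fun σ _ => (rename_mul_apply τ σ P).symm

/-- A sign-equivariant operator that is linear over the symmetric polynomials and sends `x` to `1`
is division of the antisymmetrization by that of `x`. -/
theorem antisymmetrize_mul_map (T : R n →+ R n)
    (hsign : ∀ (σ : Equiv.Perm (Fin n)) (Q : R n),
      T (rename σ Q) = (Equiv.Perm.sign σ : ℤ) • T Q)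
    (hlin : ∀ S P : R n, S.IsSymmetric → T (S * P) = S * T P)
    {x : R n} (hx : T x = 1) (hx0 : antisymmetrize x ≠ 0) (P : R n) :
    antisymmetrize x * T P = antisymmetrize P := by
  have key (P Q : R n) :
      T (P * antisymmetrize Q) = (∑ σ : Equiv.Perm (Fin n), rename σ P) * T Q := by
    rw [← hlin _ _ (isSymmetric_sum_rename P), Finset.sum_mul, antisymmetrize, Finset.mul_sum,
      map_sum, map_sum, ← Equiv.sum_comp (Equiv.inv (Equiv.Perm (Fin n)))
        fun σ => T (rename σ P * Q)]
    refine Finset.sum_congr rfl fun σ _ => ?_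
    have h : P * rename σ Q = rename σ (rename (σ⁻¹ : Equiv.Perm (Fin n)) P * Q) := by
      rw [map_mul, ← rename_mul_apply, mul_inv_cancel]
      congr 1
      exact (rename_id_apply P).symm
    rw [mul_smul_comm, map_zsmul, h, hsign, sign_smul_sign_smul]
    rfl
  have h1 := key (antisymmetrize x * P) x
  have h2 : antisymmetrize x * P * antisymmetrize x = antisymmetrize x * antisymmetrize x * P := by ring
  rw [hx, mul_one, h2, hlin _ _ (isSymmetric_antisymmetrize_sq x)] at h1
  apply mul_left_cancel₀ hx0
  rw [← mul_assoc, h1, antisymmetrize.eq_1 P, Finset.mul_sum]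
  refine Finset.sum_congr rfl fun σ _ => ?_
  rw [map_mul, rename_antisymmetrize, smul_mul_assoc, mul_smul_comm]

/-- The monomial with exponents `f 0, …, f (n - 1)`. -/
noncomputable def monom (n : ℕ) (f : ℕ → ℕ) : R n := ∏ a : Fin n, X a ^ f a

theorem monom_congr {f g : ℕ → ℕ} (h : ∀ i < n, f i = g i) : monom n f = monom n g :=
  Finset.prod_congr rfl fun a _ => by rw [h a a.2]

theorem antisymmetrize_monom_id : antisymmetrize (monom n id)
    = (Matrix.vandermonde (X : Fin n → R n)).det := by
  rw [Matrix.det_apply', antisymmetrize]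
  refine Finset.sum_congr rfl fun σ _ => ?_
  rw [monom, map_prod, zsmul_eq_mul]
  simp [Matrix.vandermonde]

theorem rename_adj_monom {i : ℕ} (h : i + 1 < n) {f : ℕ → ℕ} (hf : f (i + 1) = f i) :
    rename (adj i h) (monom n f) = monom n f := by
  rw [monom, map_prod, ← Equiv.prod_comp (adj i h) fun a => (X a : R n) ^ f a]
  refine Finset.prod_congr rfl fun a _ => ?_
  rw [map_pow, rename_X]
  congr 1
  rw [adj, Equiv.swap_apply_def]
  split_ifs with h1 h2
  · subst h1; exact hf.symm
  · subst h2; exact hf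
  · rfl

theorem IsDemFamily.D_monom {D : ℕ → R n → R n} (hD : IsDemFamily D) {i : ℕ} (h : i + 1 < n)
    {f : ℕ → ℕ} (hf : f (i + 1) = f i + 1) :
    D i (monom n f) = monom n (Function.update f (i + 1) (f i)) := by
  have hm : monom n f = X ⟨i + 1, h⟩ * monom n (Function.update f (i + 1) (f i)) := by
    rw [monom, monom, ← Finset.mul_prod_erase _ _ (Finset.mem_univ (⟨i + 1, h⟩ : Fin n)),
      ← Finset.mul_prod_erase _ (fun a : Fin n => (X a : R n) ^ Function.update f (i + 1) (f i) a)
        (Finset.mem_univ (⟨i + 1, h⟩ : Fin n)), ← mul_assoc]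
    congr 1
    · simp [hf, pow_succ']
    · refine Finset.prod_congr rfl fun a ha => ?_
      rw [Function.update_of_ne]
      intro h'
      exact Finset.ne_of_mem_erase ha (Fin.ext h')
  rw [hm, hD.D_X_mul_of_invariant h (rename_adj_monom h (by simp))]

theorem IsDemFamily.block_monom {D : ℕ → R n → R n} (hD : IsDemFamily D) (d : ℕ)
    (hd : d + 1 < n) (k a : ℕ) (h : a + k = d + 1) :
    NilCoxeter.block hD.revEnd a k (monom n fun i => min i (n - 1 - d))
      = monom n fun i => if i ≤ n - 1 - a then min i (n - 2 - d) else n - 1 - d := by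
  induction k generalizing a with
  | zero =>
    simp only [NilCoxeter.block, AddMonoid.End.coe_one, id_eq]
    refine monom_congr fun i hi => ?_
    split_ifs <;> omega
  | succ k ih =>
    rw [NilCoxeter.block, addEnd_mul_apply, ih (a + 1) (by omega), revEnd,
      if_pos (by omega), hD.stepEnd_apply (by omega), hD.D_monom (by omega)]
    · refine monom_congr fun i hi => ?_
      rw [Function.update_apply]
      split_ifs <;> omega
    · split_ifs <;> omega

theorem IsDemFamily.longest_monom {D : ℕ → R n → R n} (hD : IsDemFamily D) (d : ℕ)
    (hd : d + 1 ≤ n) :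
    NilCoxeter.longest hD.revEnd d (monom n id) = monom n fun i => min i (n - 1 - d) := by
  induction d with
  | zero =>
    simp only [NilCoxeter.longest, AddMonoid.End.coe_one, id_eq]
    exact monom_congr fun i hi => by simp; omega
  | succ d ih =>
    rw [NilCoxeter.longest, addEnd_mul_apply, ih (by omega),
      hD.block_monom d (by omega) _ _ (by omega)]
    refine monom_congr fun i hi => ?_
    split_ifs <;> omega

theorem IsDemFamily.longest_monom_eq_one {D : ℕ → R n → R n} (hD : IsDemFamily D) (hn : 1 ≤ n) :
    NilCoxeter.longest hD.revEnd (n - 1) (monom n id) = 1 := by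
  rw [hD.longest_monom _ (by omega)]
  simp [monom]

theorem det_vandermonde_X : (Matrix.vandermonde (X : Fin n → R n)).det
    = ∏ p ∈ Finset.univ.filter (fun p : Fin n × Fin n => p.2 < p.1), (X p.1 - X p.2) := by
  rw [Matrix.det_vandermonde, Finset.prod_filter, Fintype.prod_prod_type_right]
  refine Finset.prod_congr rfl fun i _ => ?_
  rw [← Finset.prod_filter, Finset.filter_lt_eq_Ioi]

/-- The automorphisms permuting the variables are linearly independent. -/
theorem coeff_eq_zero_of_sum_rename (c : Equiv.Perm (Fin n) → R n)
    (h : ∀ P : R n, ∑ σ, c σ * rename σ P = 0) (σ : Equiv.Perm (Fin n)) : c σ = 0 := by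
  have hinj : Function.Injective fun σ : Equiv.Perm (Fin n) =>
      ((rename σ : R n →ₐ[ℤ] R n) : R n →* R n) := by
    intro σ τ e
    ext1 a
    have := DFunLike.congr_fun e (X a)
    simpa using this
  have hli := (linearIndependent_monoidHom (R n) (R n)).comp _ hinj
  rw [Fintype.linearIndependent_iff] at hli
  refine hli c ?_ σ
  ext1 P
  simpa using h P

end Dem

open Dem in
/-- If `(v_w)_{w ∈ W}` is a basis of `ℤ[X_1,…,X_n]` over the
symmetric polynomials and `(v_w^∨)` satisfies `∂_{w₀}(v_{w'} v_w^∨) = δ_{w,w'}`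
(`w₀` the longest element), then `∑_w v_w^∨ v_w = ∏_{j<i} (X_i - X_j)`. -/
theorem statement7 (n : ℕ) (hn : 1 ≤ n) (W : Type) [Fintype W] [DecidableEq W]
    (v vdual : W → R n)
    (hspan : ∀ P : R n, ∃ c : W → R n,
      (∀ w, (c w).IsSymmetric) ∧ P = ∑ w, c w * v w)
    (hindep : ∀ c : W → R n, (∀ w, (c w).IsSymmetric) →
      ∑ w, c w * v w = 0 → ∀ w, c w = 0)
    (D : ℕ → R n → R n) (hD : IsDemFamily D)
    (l : List ℕ) (hl : IsReducedWordFor n l Fin.revPerm)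
    (hdual : ∀ w w' : W,
      applyWord D l (v w' * vdual w) = if w = w' then 1 else 0) :
    ∑ w, vdual w * v w
      = ∏ p ∈ Finset.univ.filter (fun p : Fin n × Fin n => p.2 < p.1),
          (MvPolynomial.X p.1 - MvPolynomial.X p.2) := by
  obtain ⟨hlt, hperm, -⟩ := hl
  have hlen : n.choose 2 ≤ l.length := by
    have := card_inversions_permOfWord_le l hlt
    rwa [hperm, card_inversions_revPerm] at this
  obtain ⟨w₀⟩ : Nonempty W := by
    by_contra hW
    rw [not_nonempty_iff] at hW
    obtain ⟨c, -, hc⟩ := hspan 1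
    simp at hc
  have hlongest := (hD.applyWord_eq_longest hn l hlt hlen).resolve_left fun h0 => by
    have := hdual w₀ w₀
    rw [h0, if_pos rfl] at this
    exact zero_ne_one this
  let T : R n →+ R n := AddMonoidHom.mk' (applyWord D l) (hD.applyWord_add l hlt)
  have hsign := map_rename_eq_sign_smul T fun i h Q => hD.applyWord_rename_adj hn l hlt hlen h Q
  have hlin : ∀ S P : R n, S.IsSymmetric → T (S * P) = S * T P :=
    fun S P hS => hD.applyWord_symm_mul l hlt hS P
  have hΔ : antisymmetrize (monom n id) ≠ 0 := by
    rw [antisymmetrize_monom_id, Matrix.det_vandermonde_ne_zero_iff]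
    exact MvPolynomial.X_injective
  have hT := antisymmetrize_mul_map T hsign hlin
    ((hlongest _).trans (hD.longest_monom_eq_one hn)) hΔ
  rw [← det_vandermonde_X, ← antisymmetrize_monom_id]
  have hexp (P : R n) :
      antisymmetrize (monom n id) * P = ∑ w, antisymmetrize (P * vdual w) * v w := by
    obtain ⟨c, hc, hP⟩ := hspan P
    have hcoef (w : W) : T (P * vdual w) = c w := by
      have hd (w' : W) : T (v w' * vdual w) = if w = w' then 1 else 0 := hdual w w'
      conv_lhs => rw [hP, Finset.sum_mul, map_sum]
      have (w' : W) : T (c w' * v w' * vdual w) = if w = w' then c w' else 0 := by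
        rw [mul_assoc, hlin _ _ (hc w'), hd, mul_ite, mul_one, mul_zero]
      simp only [this, Finset.sum_ite_eq, Finset.mem_univ, if_true]
    conv_lhs => rw [hP, Finset.mul_sum]
    refine Finset.sum_congr rfl fun w _ => ?_
    rw [← hT (P * vdual w), hcoef, mul_assoc]
  have hid (P : R n) : MvPolynomial.rename (1 : Equiv.Perm (Fin n)) P = P :=
    MvPolynomial.rename_id_apply P
  have hzero := coeff_eq_zero_of_sum_rename
    (fun σ => (Equiv.Perm.sign σ : ℤ) • (∑ w, MvPolynomial.rename σ (vdual w) * v w)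
      - if σ = 1 then antisymmetrize (monom n id) else 0) (fun P => by
    simp only [sub_mul, Finset.sum_sub_distrib, ite_mul, zero_mul, Finset.sum_ite_eq',
      Finset.mem_univ, if_true]
    rw [hid, hexp, sub_eq_zero]
    simp only [antisymmetrize, Finset.sum_mul, Finset.smul_sum]
    rw [Finset.sum_comm]
    refine Finset.sum_congr rfl fun w _ => Finset.sum_congr rfl fun σ _ => ?_
    rw [map_mul, smul_mul_assoc, smul_mul_assoc]
    congr 1
    ring) 1
  simpa only [hid, Equiv.Perm.sign_one, Units.val_one, one_smul, if_true, sub_eq_zero] using hzero
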